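/- An abelian group G of unbounded period (i.e., not of finite exponent) is a strong retract if and only if G is divisible. -/

import Mathlib

universe u

/-- `K` belongs to the variety generated by `H`: every identity (word in a free group)
that holds identically in `H` also holds identically in `K`. -/
def InVarietyOf (H : Type u) [Group H] (K : Type u) [Group K] : Prop :=
  ∀ (n : ℕ) (w : FreeGroup (Fin n)),
    (∀ f : Fin n → H, FreeGroup.lift f w = 1) →
    ∀ f : Fin n → K, FreeGroup.lift f w = 1

/-- `H` is a strong retract: for every group `G` in the variety generated by `H`
containing `H` (via an injective homomorphism `ι`), there is a retraction of `G`
onto (the copy of) `H`. -/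
def IsStrongRetract (H : Type u) [Group H] : Prop :=
  ∀ (G : Type u) [Group G], ∀ ι : H →* G, Function.Injective ι →
    InVarietyOf H G → ∃ ρ : G →* H, ∀ h : H, ρ (ι h) = h

/-- The value of a word in a commutative group is the product of the values of its letters, raised
to their exponent sums. -/
lemma FreeGroup.lift_eq_prod_zpow {α K : Type*} [Fintype α] [DecidableEq α] [CommGroup K]
    (f : α → K) (w : FreeGroup α) :
    FreeGroup.lift f w =
      ∏ i, f i ^ (FreeGroup.lift (Pi.mulSingle i (Multiplicative.ofAdd (1 : ℤ))) w).toAdd := by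
  have h : FreeGroup.lift f = ∏ i, (zpowersHom K (f i)).comp
      (FreeGroup.lift (Pi.mulSingle i (Multiplicative.ofAdd (1 : ℤ)))) := by
    ext j
    rw [MonoidHom.finsetProd_apply, Finset.prod_eq_single j]
    · simp
    · intro i _ hij
      simp [Pi.mulSingle_eq_of_ne hij.symm]
    · simp
  simpa [MonoidHom.finsetProd_apply] using DFunLike.congr_fun h w

/-- A commutative group of unbounded exponent satisfies only the identities that hold in every
commutative group. -/
lemma inVarietyOf_of_unbounded {G K : Type u} [CommGroup G] [CommGroup K]
    (hub : ¬ ∃ n : ℕ, 1 ≤ n ∧ ∀ g : G, g ^ n = 1) : InVarietyOf G K := by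
  intro n w hw f
  rw [FreeGroup.lift_eq_prod_zpow]
  refine Finset.prod_eq_one fun i _ => ?_
  set e := (FreeGroup.lift (Pi.mulSingle i (Multiplicative.ofAdd (1 : ℤ))) w).toAdd with he
  suffices e = 0 by rw [this, zpow_zero]
  by_contra hne
  refine hub ⟨e.natAbs, Int.natAbs_pos.mpr hne, fun g => ?_⟩
  have h := hw (Pi.mulSingle i g)
  rw [FreeGroup.lift_eq_prod_zpow, Finset.prod_eq_single i
    (fun j _ hj => by rw [Pi.mulSingle_eq_of_ne hj, one_zpow]) (by simp),
    Pi.mulSingle_eq_same, ← he] at h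
  rwa [pow_natAbs_eq_one]

/-- Every group in the variety generated by a commutative group is commutative. -/
lemma InVarietyOf.mul_comm {G K : Type u} [CommGroup G] [Group K] (h : InVarietyOf G K) (a b : K) :
    a * b = b * a := by
  have := h 2 (.of 0 * .of 1 * (.of 1 * .of 0)⁻¹) (fun f => by simp [← mul_assoc]) ![a, b]
  rw [map_mul, map_inv, mul_inv_eq_one] at this
  simpa using this

/-- A divisible subgroup of a commutative group is a retract. -/
lemma exists_retraction_of_divisible {G K : Type u} [CommGroup G] [CommGroup K]
    (hdiv : ∀ (g : G) (n : ℕ), 1 ≤ n → ∃ x : G, x ^ n = g)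
    (ι : G →* K) (hι : Function.Injective ι) : ∃ ρ : K →* G, ∀ g, ρ (ι g) = g := by
  have hsurj : ∀ {n : ℤ}, n ≠ 0 →
      Function.Surjective (fun a : Additive G => n • a) := by
    intro n hn a
    obtain ⟨x, hx⟩ := hdiv (a.toMul ^ n.sign) n.natAbs (Int.natAbs_pos.mpr hn)
    refine ⟨Additive.ofMul x, Additive.toMul.injective ?_⟩
    have hx' : x ^ n = (x ^ n.natAbs) ^ n.sign := by
      rw [← zpow_natCast, ← zpow_mul, mul_comm, Int.sign_mul_natAbs]
    simp only [toMul_zsmul, toMul_ofMul]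
    rw [hx', hx]
    rcases hn.lt_or_gt with h | h
    · simp [Int.sign_eq_neg_one_of_neg h]
    · simp [Int.sign_eq_one_of_pos h]
  let _ : DivisibleBy (Additive G) ℤ := divisibleByOfSMulRightSurj _ _ hsurj
  obtain ⟨r, hr⟩ := (Module.Baer.of_divisible (Additive G)).extension_property_addMonoidHom
    (MonoidHom.toAdditive ι) hι (AddMonoidHom.id _)
  exact ⟨MonoidHom.toAdditive.symm r, fun g => DFunLike.congr_fun hr (Additive.ofMul g)⟩

/-- Every element of a commutative group acquires an `n`-th root in a commutative overgroup. -/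
lemma exists_commGroup_extension_pow_eq {G : Type u} [CommGroup G] (g : G) {n : ℕ} (hn : n ≠ 0) :
    ∃ (K : Type u) (_ : CommGroup K) (ι : G →* K),
      Function.Injective ι ∧ ∃ y : K, y ^ n = ι g := by
  let N : Subgroup (G × Multiplicative ℤ) := Subgroup.zpowers (g⁻¹, Multiplicative.ofAdd (n : ℤ))
  refine ⟨(G × Multiplicative ℤ) ⧸ N, inferInstance,
    (QuotientGroup.mk' N).comp (MonoidHom.inl _ _), ?_,
    QuotientGroup.mk' N (1, Multiplicative.ofAdd 1), ?_⟩
  · rw [injective_iff_map_eq_one]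
    intro a ha
    obtain ⟨k, hk⟩ := Subgroup.mem_zpowers_iff.mp ((QuotientGroup.eq_one_iff _).mp ha)
    have h₂ : k * (n : ℤ) = 0 := by
      simpa [← ofAdd_zsmul] using congrArg Prod.snd hk
    have hk₀ : k = 0 := by simpa [hn] using h₂
    simpa [hk₀] using (congrArg Prod.fst hk).symm
  · rw [← map_pow, eq_comm]
    refine QuotientGroup.eq.mpr (Subgroup.mem_zpowers_iff.mpr ⟨1, ?_⟩)
    ext <;> simp [← ofAdd_nsmul]

/-- Proposition 1: an abelian group of unbounded period is a strong retract
if and only if it is divisible. -/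
theorem abelian_unbounded_strong_retract_iff_divisible (G : Type u) [CommGroup G]
    (hub : ¬ ∃ n : ℕ, 1 ≤ n ∧ ∀ g : G, g ^ n = 1) :
    IsStrongRetract G ↔ ∀ (g : G) (n : ℕ), 1 ≤ n → ∃ x : G, x ^ n = g := by
  constructor
  · intro h g n hn
    obtain ⟨K, _, ι, hι, y, hy⟩ :=
      exists_commGroup_extension_pow_eq g (Nat.one_le_iff_ne_zero.mp hn)
    obtain ⟨ρ, hρ⟩ := h K ι hι (inVarietyOf_of_unbounded hub)
    exact ⟨ρ y, by rw [← map_pow, hy, hρ]⟩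
  · intro hdiv K _ ι hι hK
    let _ : CommGroup K := { mul_comm := hK.mul_comm }
    exact exists_retraction_of_divisible hdiv ι hι
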